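/- Fix real constants a,b,c. Let T = q1⁴(3q1+q2)p1²/(q1−q2) + q2⁴(q1+3q2)p2²/(q2−q1), V̂ = a(q1²+6q1q2+q2²)(q1−q2)²/(q1⁴q2⁴) + b q1²q2²/(q1+q2)² + c(q1−q2)²/(q1²q2²), K̂1 = q1²p1+q2²p2, K̂2 = q1²q2²(q1²p1−q2²p2)²/(q1−q2)², Û1 = −a(q1−q2)⁴/(q1⁴q2⁴) + 2b q1²q2²/(q1+q2)², Û2 = −2a(3q1²+2q1q2+3q2²)/(q1²q2²) + 2c. Then H1 = T+V̂ and H2 = (K̂1²+Û1)(K̂2+Û2)² satisfy {H1,H2} = 0 on the open set where q1,q2,q1−q2,q1+q2 are nonzero. -/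

import Mathlib

/-- Canonical Poisson bracket of two functions on phase space (q1,q2,p1,p2). -/
noncomputable def pb (f g : ℝ → ℝ → ℝ → ℝ → ℝ) (q1 q2 p1 p2 : ℝ) : ℝ :=
  (deriv (fun x => f x q2 p1 p2) q1) * (deriv (fun x => g q1 q2 x p2) p1)
  - (deriv (fun x => f q1 q2 x p2) p1) * (deriv (fun x => g x q2 p1 p2) q1)
  + (deriv (fun x => f q1 x p1 p2) q2) * (deriv (fun x => g q1 q2 p1 x) p2)
  - (deriv (fun x => f q1 q2 p1 x) p2) * (deriv (fun x => g q1 x p1 p2) q2)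

noncomputable def H1 (a b c q1 q2 p1 p2 : ℝ) : ℝ :=
  q1^4 * (3*q1 + q2) * p1^2 / (q1 - q2) + q2^4 * (q1 + 3*q2) * p2^2 / (q2 - q1)
  + a * (q1^2 + 6*q1*q2 + q2^2) * (q1 - q2)^2 / (q1^4*q2^4)
  + b * q1^2*q2^2 / (q1 + q2)^2 + c * (q1 - q2)^2 / (q1^2*q2^2)

noncomputable def H2 (a b c q1 q2 p1 p2 : ℝ) : ℝ :=
  ((q1^2*p1 + q2^2*p2)^2
    + (-a*(q1 - q2)^4/(q1^4*q2^4) + 2*b*q1^2*q2^2/(q1 + q2)^2))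
  * (q1^2*q2^2*(q1^2*p1 - q2^2*p2)^2/(q1 - q2)^2
    + (-2*a*(3*q1^2 + 2*q1*q2 + 3*q2^2)/(q1^2*q2^2) + 2*c))^2

/-- The factor `K̂1² + Û1` of `H2`. -/
noncomputable def quadFactor (a b q1 q2 p1 p2 : ℝ) : ℝ :=
  (q1^2*p1 + q2^2*p2)^2
    + (-a*(q1 - q2)^4/(q1^4*q2^4) + 2*b*q1^2*q2^2/(q1 + q2)^2)

/-- The factor `K̂2 + Û2` of `H2`, which enters squared. -/
noncomputable def squaredFactor (a c q1 q2 p1 p2 : ℝ) : ℝ :=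
  q1^2*q2^2*(q1^2*p1 - q2^2*p2)^2/(q1 - q2)^2
    + (-2*a*(3*q1^2 + 2*q1*q2 + 3*q2^2)/(q1^2*q2^2) + 2*c)

/-- The bracket with a product `F * G^2` vanishes when `F` and `G` are relative invariants
with cofactors `-2 * M` and `M`. -/
theorem pb_mul_sq_eq_zero {f F G : ℝ → ℝ → ℝ → ℝ → ℝ} {q1 q2 p1 p2 M : ℝ}
    (hF1 : DifferentiableAt ℝ (fun x => F x q2 p1 p2) q1)
    (hF2 : DifferentiableAt ℝ (fun x => F q1 x p1 p2) q2)
    (hF3 : DifferentiableAt ℝ (fun x => F q1 q2 x p2) p1)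
    (hF4 : DifferentiableAt ℝ (fun x => F q1 q2 p1 x) p2)
    (hG1 : DifferentiableAt ℝ (fun x => G x q2 p1 p2) q1)
    (hG2 : DifferentiableAt ℝ (fun x => G q1 x p1 p2) q2)
    (hG3 : DifferentiableAt ℝ (fun x => G q1 q2 x p2) p1)
    (hG4 : DifferentiableAt ℝ (fun x => G q1 q2 p1 x) p2)
    (hF : pb f F q1 q2 p1 p2 = -2 * M * F q1 q2 p1 p2)
    (hG : pb f G q1 q2 p1 p2 = M * G q1 q2 p1 p2) :
    pb f (fun q1 q2 p1 p2 => F q1 q2 p1 p2 * G q1 q2 p1 p2 ^ 2) q1 q2 p1 p2 = 0 := by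
  have e1 := (hF1.hasDerivAt.fun_mul (hG1.hasDerivAt.fun_pow 2)).deriv
  have e2 := (hF2.hasDerivAt.fun_mul (hG2.hasDerivAt.fun_pow 2)).deriv
  have e3 := (hF3.hasDerivAt.fun_mul (hG3.hasDerivAt.fun_pow 2)).deriv
  have e4 := (hF4.hasDerivAt.fun_mul (hG4.hasDerivAt.fun_pow 2)).deriv
  unfold pb at hF hG ⊢
  rw [e1, e2, e3, e4]
  push_cast
  linear_combination G q1 q2 p1 p2 ^ 2 * hF
    + 2 * F q1 q2 p1 p2 * G q1 q2 p1 p2 * hG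

theorem hasDerivAt_H1_q1 (a b c q1 q2 p1 p2 : ℝ)
    (h1 : q1 ≠ 0) (h2 : q2 ≠ 0) (h3 : q1 - q2 ≠ 0)
    (h4 : q1 + q2 ≠ 0) :
    HasDerivAt (fun x => H1 a b c x q2 p1 p2)
      ((15*q1^4 + 4*q1^3*q2)*p1^2/(q1 - q2)
      - q1^4*(3*q1 + q2)*p1^2/(q1 - q2)^2
      + q2^4*p2^2/(q2 - q1) + q2^4*(q1 + 3*q2)*p2^2/(q2 - q1)^2
      + a*((2*q1 + 6*q2)*(q1 - q2)^2 + 2*(q1^2 + 6*q1*q2 + q2^2)*(q1 - q2))/(q1^4*q2^4)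
      - 4*a*(q1^2 + 6*q1*q2 + q2^2)*(q1 - q2)^2/(q1^5*q2^4)
      + 2*b*q1*q2^2/(q1 + q2)^2 - 2*b*q1^2*q2^2/(q1 + q2)^3
      + 2*c*(q1 - q2)/(q1^2*q2^2) - 2*c*(q1 - q2)^2/(q1^3*q2^2)) q1 := by
  have hx := hasDerivAt_id' q1
  have h5 : q2 - q1 ≠ 0 := by rwa [← neg_sub, neg_ne_zero]
  unfold H1
  refine HasDerivAt.congr_deriv
    ((((((((hx.fun_pow 4).fun_mul ((hx.const_mul 3).add_const q2)).mul_const (p1 ^ 2)).fun_div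
      (hx.sub_const q2) h3).fun_add ((((hx.add_const (3 * q2)).const_mul (q2 ^ 4)).mul_const (p2 ^
      2)).fun_div (hx.const_sub q2) h5)).fun_add ((((((hx.fun_pow 2).fun_add ((hx.const_mul
      6).mul_const q2)).add_const (q2 ^ 2)).const_mul a).fun_mul ((hx.sub_const q2).fun_pow
      2)).fun_div ((hx.fun_pow 4).mul_const (q2 ^ 4)) (mul_ne_zero (pow_ne_zero 4 h1) (pow_ne_zero
      4 h2)))).fun_add ((((hx.fun_pow 2).const_mul b).mul_const (q2 ^ 2)).fun_div ((hx.add_const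
      q2).fun_pow 2) (pow_ne_zero 2 h4))).fun_add ((((hx.sub_const q2).fun_pow 2).const_mul
      c).fun_div ((hx.fun_pow 2).mul_const (q2 ^ 2)) (mul_ne_zero (pow_ne_zero 2 h1) (pow_ne_zero
      2 h2)))) ?_
  have e : q2 - q1 = -(q1 - q2) := by ring
  rw [e]
  push_cast
  field_simp
  ring

theorem hasDerivAt_H1_q2 (a b c q1 q2 p1 p2 : ℝ)
    (h1 : q1 ≠ 0) (h2 : q2 ≠ 0) (h3 : q1 - q2 ≠ 0)
    (h4 : q1 + q2 ≠ 0) :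
    HasDerivAt (fun x => H1 a b c q1 x p1 p2)
      (q1^4*p1^2/(q1 - q2) + q1^4*(3*q1 + q2)*p1^2/(q1 - q2)^2
      + (15*q2^4 + 4*q2^3*q1)*p2^2/(q2 - q1) - q2^4*(q1 + 3*q2)*p2^2/(q2 - q1)^2
      + a*((2*q2 + 6*q1)*(q1 - q2)^2 - 2*(q1^2 + 6*q1*q2 + q2^2)*(q1 - q2))/(q1^4*q2^4)
      - 4*a*(q1^2 + 6*q1*q2 + q2^2)*(q1 - q2)^2/(q1^4*q2^5)
      + 2*b*q1^2*q2/(q1 + q2)^2 - 2*b*q1^2*q2^2/(q1 + q2)^3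
      - 2*c*(q1 - q2)/(q1^2*q2^2) - 2*c*(q1 - q2)^2/(q1^2*q2^3)) q2 := by
  have hx := hasDerivAt_id' q2
  have h5 : q2 - q1 ≠ 0 := by rwa [← neg_sub, neg_ne_zero]
  unfold H1
  refine HasDerivAt.congr_deriv
    ((((((((hx.const_add (3 * q1)).const_mul (q1 ^ 4)).mul_const (p1 ^ 2)).fun_div (hx.const_sub
      q1) h3).fun_add ((((hx.fun_pow 4).fun_mul ((hx.const_mul 3).const_add q1)).mul_const (p2 ^
      2)).fun_div (hx.sub_const q1) h5)).fun_add ((((((hx.const_mul (6 * q1)).const_add (q1 ^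
      2)).fun_add (hx.fun_pow 2)).const_mul a).fun_mul ((hx.const_sub q1).fun_pow 2)).fun_div
      ((hx.fun_pow 4).const_mul (q1 ^ 4)) (mul_ne_zero (pow_ne_zero 4 h1) (pow_ne_zero 4
      h2)))).fun_add (((hx.fun_pow 2).const_mul (b * q1 ^ 2)).fun_div ((hx.const_add q1).fun_pow
      2) (pow_ne_zero 2 h4))).fun_add ((((hx.const_sub q1).fun_pow 2).const_mul c).fun_div
      ((hx.fun_pow 2).const_mul (q1 ^ 2)) (mul_ne_zero (pow_ne_zero 2 h1) (pow_ne_zero 2 h2)))) ?_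
  have e : q2 - q1 = -(q1 - q2) := by ring
  rw [e]
  push_cast
  field_simp
  ring

theorem hasDerivAt_H1_p1 (a b c q1 q2 p1 p2 : ℝ) :
    HasDerivAt (fun x => H1 a b c q1 q2 x p2)
      (2*q1^4*(3*q1 + q2)*p1/(q1 - q2)) p1 := by
  have hx := hasDerivAt_id' p1
  unfold H1
  refine HasDerivAt.congr_deriv
    (((((((hx.fun_pow 2).const_mul (q1 ^ 4 * (3 * q1 + q2))).div_const (q1 - q2)).add_const (q2 ^
      4 * (q1 + 3 * q2) * p2 ^ 2 / (q2 - q1))).add_const (a * (q1 ^ 2 + 6 * q1 * q2 + q2 ^ 2) *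
      (q1 - q2) ^ 2 / (q1 ^ 4 * q2 ^ 4))).add_const (b * q1 ^ 2 * q2 ^ 2 / (q1 + q2) ^
      2)).add_const (c * (q1 - q2) ^ 2 / (q1 ^ 2 * q2 ^ 2))) ?_
  push_cast
  ring

theorem hasDerivAt_H1_p2 (a b c q1 q2 p1 p2 : ℝ) :
    HasDerivAt (fun x => H1 a b c q1 q2 p1 x)
      (2*q2^4*(q1 + 3*q2)*p2/(q2 - q1)) p2 := by
  have hx := hasDerivAt_id' p2
  unfold H1
  refine HasDerivAt.congr_deriv
    (((((((hx.fun_pow 2).const_mul (q2 ^ 4 * (q1 + 3 * q2))).div_const (q2 - q1)).const_add (q1 ^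
      4 * (3 * q1 + q2) * p1 ^ 2 / (q1 - q2))).add_const (a * (q1 ^ 2 + 6 * q1 * q2 + q2 ^ 2) *
      (q1 - q2) ^ 2 / (q1 ^ 4 * q2 ^ 4))).add_const (b * q1 ^ 2 * q2 ^ 2 / (q1 + q2) ^
      2)).add_const (c * (q1 - q2) ^ 2 / (q1 ^ 2 * q2 ^ 2))) ?_
  push_cast
  ring

theorem hasDerivAt_quadFactor_q1 (a b q1 q2 p1 p2 : ℝ)
    (h1 : q1 ≠ 0) (h2 : q2 ≠ 0) (h4 : q1 + q2 ≠ 0) :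
    HasDerivAt (fun x => quadFactor a b x q2 p1 p2)
      (4*q1*p1*(q1^2*p1 + q2^2*p2) - 4*a*(q1 - q2)^3/(q1^4*q2^4)
      + 4*a*(q1 - q2)^4/(q1^5*q2^4)
      + 4*b*q1*q2^2/(q1 + q2)^2 - 4*b*q1^2*q2^2/(q1 + q2)^3) q1 := by
  have hx := hasDerivAt_id' q1
  unfold quadFactor
  refine HasDerivAt.congr_deriv
    (((((hx.fun_pow 2).mul_const p1).add_const (q2 ^ 2 * p2)).fun_pow 2).fun_add (((((hx.sub_const
      q2).fun_pow 4).const_mul (-a)).fun_div ((hx.fun_pow 4).mul_const (q2 ^ 4)) (mul_ne_zero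
      (pow_ne_zero 4 h1) (pow_ne_zero 4 h2))).fun_add ((((hx.fun_pow 2).const_mul (2 *
      b)).mul_const (q2 ^ 2)).fun_div ((hx.add_const q2).fun_pow 2) (pow_ne_zero 2 h4)))) ?_
  push_cast
  field_simp
  ring

theorem hasDerivAt_quadFactor_q2 (a b q1 q2 p1 p2 : ℝ)
    (h1 : q1 ≠ 0) (h2 : q2 ≠ 0) (h4 : q1 + q2 ≠ 0) :
    HasDerivAt (fun x => quadFactor a b q1 x p1 p2)
      (4*q2*p2*(q1^2*p1 + q2^2*p2) + 4*a*(q1 - q2)^3/(q1^4*q2^4)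
      + 4*a*(q1 - q2)^4/(q1^4*q2^5)
      + 4*b*q1^2*q2/(q1 + q2)^2 - 4*b*q1^2*q2^2/(q1 + q2)^3) q2 := by
  have hx := hasDerivAt_id' q2
  unfold quadFactor
  refine HasDerivAt.congr_deriv
    (((((hx.fun_pow 2).mul_const p2).const_add (q1 ^ 2 * p1)).fun_pow 2).fun_add (((((hx.const_sub
      q1).fun_pow 4).const_mul (-a)).fun_div ((hx.fun_pow 4).const_mul (q1 ^ 4)) (mul_ne_zero
      (pow_ne_zero 4 h1) (pow_ne_zero 4 h2))).fun_add (((hx.fun_pow 2).const_mul (2 * b * q1 ^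
      2)).fun_div ((hx.const_add q1).fun_pow 2) (pow_ne_zero 2 h4)))) ?_
  push_cast
  field_simp
  ring

theorem hasDerivAt_quadFactor_p1 (a b q1 q2 p1 p2 : ℝ) :
    HasDerivAt (fun x => quadFactor a b q1 q2 x p2)
      (2*q1^2*(q1^2*p1 + q2^2*p2)) p1 := by
  have hx := hasDerivAt_id' p1
  unfold quadFactor
  refine HasDerivAt.congr_deriv
    ((((hx.const_mul (q1 ^ 2)).add_const (q2 ^ 2 * p2)).fun_pow 2).add_const (-a * (q1 - q2) ^ 4 /
      (q1 ^ 4 * q2 ^ 4) + 2 * b * q1 ^ 2 * q2 ^ 2 / (q1 + q2) ^ 2)) ?_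
  push_cast
  ring

theorem hasDerivAt_quadFactor_p2 (a b q1 q2 p1 p2 : ℝ) :
    HasDerivAt (fun x => quadFactor a b q1 q2 p1 x)
      (2*q2^2*(q1^2*p1 + q2^2*p2)) p2 := by
  have hx := hasDerivAt_id' p2
  unfold quadFactor
  refine HasDerivAt.congr_deriv
    ((((hx.const_mul (q2 ^ 2)).const_add (q1 ^ 2 * p1)).fun_pow 2).add_const (-a * (q1 - q2) ^ 4 /
      (q1 ^ 4 * q2 ^ 4) + 2 * b * q1 ^ 2 * q2 ^ 2 / (q1 + q2) ^ 2)) ?_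
  push_cast
  ring

theorem hasDerivAt_squaredFactor_q1 (a c q1 q2 p1 p2 : ℝ)
    (h1 : q1 ≠ 0) (h2 : q2 ≠ 0) (h3 : q1 - q2 ≠ 0) :
    HasDerivAt (fun x => squaredFactor a c x q2 p1 p2)
      (2*q1*q2^2*(q1^2*p1 - q2^2*p2)^2/(q1 - q2)^2
      + 4*q1^3*q2^2*p1*(q1^2*p1 - q2^2*p2)/(q1 - q2)^2
      - 2*q1^2*q2^2*(q1^2*p1 - q2^2*p2)^2/(q1 - q2)^3
      - 2*a*(6*q1 + 2*q2)/(q1^2*q2^2)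
      + 4*a*(3*q1^2 + 2*q1*q2 + 3*q2^2)/(q1^3*q2^2)) q1 := by
  have hx := hasDerivAt_id' q1
  unfold squaredFactor
  refine HasDerivAt.congr_deriv
    (((((hx.fun_pow 2).mul_const (q2 ^ 2)).fun_mul ((((hx.fun_pow 2).mul_const p1).sub_const (q2 ^
      2 * p2)).fun_pow 2)).fun_div ((hx.sub_const q2).fun_pow 2) (pow_ne_zero 2 h3)).fun_add
      (((((((hx.fun_pow 2).const_mul 3).fun_add ((hx.const_mul 2).mul_const q2)).add_const (3 * q2
      ^ 2)).const_mul (-2 * a)).fun_div ((hx.fun_pow 2).mul_const (q2 ^ 2)) (mul_ne_zero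
      (pow_ne_zero 2 h1) (pow_ne_zero 2 h2))).add_const (2 * c))) ?_
  push_cast
  field_simp
  ring

theorem hasDerivAt_squaredFactor_q2 (a c q1 q2 p1 p2 : ℝ)
    (h1 : q1 ≠ 0) (h2 : q2 ≠ 0) (h3 : q1 - q2 ≠ 0) :
    HasDerivAt (fun x => squaredFactor a c q1 x p1 p2)
      (2*q1^2*q2*(q1^2*p1 - q2^2*p2)^2/(q1 - q2)^2
      - 4*q1^2*q2^3*p2*(q1^2*p1 - q2^2*p2)/(q1 - q2)^2
      + 2*q1^2*q2^2*(q1^2*p1 - q2^2*p2)^2/(q1 - q2)^3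
      - 2*a*(2*q1 + 6*q2)/(q1^2*q2^2)
      + 4*a*(3*q1^2 + 2*q1*q2 + 3*q2^2)/(q1^2*q2^3)) q2 := by
  have hx := hasDerivAt_id' q2
  unfold squaredFactor
  refine HasDerivAt.congr_deriv
    (((((hx.fun_pow 2).const_mul (q1 ^ 2)).fun_mul ((((hx.fun_pow 2).mul_const p2).const_sub (q1 ^
      2 * p1)).fun_pow 2)).fun_div ((hx.const_sub q1).fun_pow 2) (pow_ne_zero 2 h3)).fun_add
      ((((((hx.const_mul (2 * q1)).const_add (3 * q1 ^ 2)).fun_add ((hx.fun_pow 2).const_mul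
      3)).const_mul (-2 * a)).fun_div ((hx.fun_pow 2).const_mul (q1 ^ 2)) (mul_ne_zero
      (pow_ne_zero 2 h1) (pow_ne_zero 2 h2))).add_const (2 * c))) ?_
  push_cast
  field_simp
  ring

theorem hasDerivAt_squaredFactor_p1 (a c q1 q2 p1 p2 : ℝ) :
    HasDerivAt (fun x => squaredFactor a c q1 q2 x p2)
      (2*q1^4*q2^2*(q1^2*p1 - q2^2*p2)/(q1 - q2)^2) p1 := by
  have hx := hasDerivAt_id' p1
  unfold squaredFactor
  refine HasDerivAt.congr_deriv
    ((((((hx.const_mul (q1 ^ 2)).sub_const (q2 ^ 2 * p2)).fun_pow 2).const_mul (q1 ^ 2 * q2 ^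
      2)).div_const ((q1 - q2) ^ 2)).add_const (-2 * a * (3 * q1 ^ 2 + 2 * q1 * q2 + 3 * q2 ^ 2) /
      (q1 ^ 2 * q2 ^ 2) + 2 * c)) ?_
  push_cast
  ring

theorem hasDerivAt_squaredFactor_p2 (a c q1 q2 p1 p2 : ℝ) :
    HasDerivAt (fun x => squaredFactor a c q1 q2 p1 x)
      (-2*q1^2*q2^4*(q1^2*p1 - q2^2*p2)/(q1 - q2)^2) p2 := by
  have hx := hasDerivAt_id' p2
  unfold squaredFactor
  refine HasDerivAt.congr_deriv
    ((((((hx.const_mul (q2 ^ 2)).const_sub (q1 ^ 2 * p1)).fun_pow 2).const_mul (q1 ^ 2 * q2 ^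
      2)).div_const ((q1 - q2) ^ 2)).add_const (-2 * a * (3 * q1 ^ 2 + 2 * q1 * q2 + 3 * q2 ^ 2) /
      (q1 ^ 2 * q2 ^ 2) + 2 * c)) ?_
  push_cast
  ring

/-- The bracket of `H1` with `quadFactor`. -/
theorem pb_H1_quadFactor (a b c q1 q2 p1 p2 : ℝ)
    (h1 : q1 ≠ 0) (h2 : q2 ≠ 0) (h3 : q1 - q2 ≠ 0) (h4 : q1 + q2 ≠ 0) :
    pb (H1 a b c) (quadFactor a b) q1 q2 p1 p2
      = -2 * (4*q1*q2*(q1^2*p1 - q2^2*p2)/(q1 - q2)) * quadFactor a b q1 q2 p1 p2 := by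
  have e : q2 - q1 = -(q1 - q2) := by ring
  unfold pb
  rw [(hasDerivAt_H1_q1 a b c q1 q2 p1 p2 h1 h2 h3 h4).deriv,
    (hasDerivAt_H1_q2 a b c q1 q2 p1 p2 h1 h2 h3 h4).deriv,
    (hasDerivAt_H1_p1 a b c q1 q2 p1 p2).deriv,
    (hasDerivAt_H1_p2 a b c q1 q2 p1 p2).deriv,
    (hasDerivAt_quadFactor_q1 a b q1 q2 p1 p2 h1 h2 h4).deriv,
    (hasDerivAt_quadFactor_q2 a b q1 q2 p1 p2 h1 h2 h4).deriv,
    (hasDerivAt_quadFactor_p1 a b q1 q2 p1 p2).deriv,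
    (hasDerivAt_quadFactor_p2 a b q1 q2 p1 p2).deriv, quadFactor, e]
  field_simp
  ring

/-- The bracket of `H1` with `squaredFactor`. -/
theorem pb_H1_squaredFactor (a b c q1 q2 p1 p2 : ℝ)
    (h1 : q1 ≠ 0) (h2 : q2 ≠ 0) (h3 : q1 - q2 ≠ 0) (h4 : q1 + q2 ≠ 0) :
    pb (H1 a b c) (squaredFactor a c) q1 q2 p1 p2
      = 4*q1*q2*(q1^2*p1 - q2^2*p2)/(q1 - q2) * squaredFactor a c q1 q2 p1 p2 := by
  have e : q2 - q1 = -(q1 - q2) := by ring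
  unfold pb
  rw [(hasDerivAt_H1_q1 a b c q1 q2 p1 p2 h1 h2 h3 h4).deriv,
    (hasDerivAt_H1_q2 a b c q1 q2 p1 p2 h1 h2 h3 h4).deriv,
    (hasDerivAt_H1_p1 a b c q1 q2 p1 p2).deriv,
    (hasDerivAt_H1_p2 a b c q1 q2 p1 p2).deriv,
    (hasDerivAt_squaredFactor_q1 a c q1 q2 p1 p2 h1 h2 h3).deriv,
    (hasDerivAt_squaredFactor_q2 a c q1 q2 p1 p2 h1 h2 h3).deriv,
    (hasDerivAt_squaredFactor_p1 a c q1 q2 p1 p2).deriv,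
    (hasDerivAt_squaredFactor_p2 a c q1 q2 p1 p2).deriv, squaredFactor, e]
  field_simp
  ring

theorem stmt12 (a b c q1 q2 p1 p2 : ℝ) (h1 : q1 ≠ 0) (h2 : q2 ≠ 0)
    (h3 : q1 ≠ q2) (h4 : q1 + q2 ≠ 0) :
    pb (H1 a b c) (H2 a b c) q1 q2 p1 p2 = 0 := by
  have h3' : q1 - q2 ≠ 0 := sub_ne_zero.mpr h3
  exact pb_mul_sq_eq_zero
    (hasDerivAt_quadFactor_q1 a b q1 q2 p1 p2 h1 h2 h4).differentiableAt
    (hasDerivAt_quadFactor_q2 a b q1 q2 p1 p2 h1 h2 h4).differentiableAt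
    (hasDerivAt_quadFactor_p1 a b q1 q2 p1 p2).differentiableAt
    (hasDerivAt_quadFactor_p2 a b q1 q2 p1 p2).differentiableAt
    (hasDerivAt_squaredFactor_q1 a c q1 q2 p1 p2 h1 h2 h3').differentiableAt
    (hasDerivAt_squaredFactor_q2 a c q1 q2 p1 p2 h1 h2 h3').differentiableAt
    (hasDerivAt_squaredFactor_p1 a c q1 q2 p1 p2).differentiableAt
    (hasDerivAt_squaredFactor_p2 a c q1 q2 p1 p2).differentiableAt
    (pb_H1_quadFactor a b c q1 q2 p1 p2 h1 h2 h3' h4)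
    (pb_H1_squaredFactor a b c q1 q2 p1 p2 h1 h2 h3' h4)
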